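/- For every 1 ≤ K < M, the increment of the Partial Effective Rank equals one exactly when the leading singular values are all equal: PER_{K+1} − PER_K = 1 if and only if σ 0 = σ 1 = ⋯ = σ K (the first K+1 singular values, indexed from zero, are all equal). -/

import Mathlib

/-- The Partial Effective Rank of a sequence of singular values `σ : Fin M → ℝ`,
truncated to the first `K` values: `PER_K = exp(H(p_{K,1}, …, p_{K,K}))` where
`p_{K,k} = σ k / (σ 0 + ⋯ + σ (K-1))` and `H` is the Shannon entropy with the
convention `0 * log 0 = 0` (note `Real.log 0 = 0` in Mathlib). -/
noncomputable def PER {M : ℕ} (σ : Fin M → ℝ) (K : ℕ) (h : K ≤ M) : ℝ :=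
  Real.exp (-∑ k : Fin K,
    (σ (Fin.castLE h k) / ∑ j : Fin K, σ (Fin.castLE h j)) *
      Real.log (σ (Fin.castLE h k) / ∑ j : Fin K, σ (Fin.castLE h j)))

open Finset in
/-- Unnormalised form of the entropy of the distribution proportional to `f`. -/
theorem neg_sum_div_mul_log_div {n : ℕ} (f : Fin n → ℝ) (hS : 0 < ∑ j, f j) :
    -∑ k, (f k / ∑ j, f j) * Real.log (f k / ∑ j, f j) =
      Real.log (∑ j, f j) - (∑ k, f k * Real.log (f k)) / ∑ j, f j := by
  set S := ∑ j, f j with hSdef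
  have hterm : ∀ k, (f k / S) * Real.log (f k / S) =
      (f k * Real.log (f k)) / S - f k * (Real.log S / S) := by
    intro k
    rcases eq_or_ne (f k) 0 with h | h
    · simp [h]
    · rw [Real.log_div h hS.ne']
      ring
  rw [sum_congr rfl fun k _ => hterm k, sum_sub_distrib, ← sum_div, ← sum_mul, ← hSdef]
  field_simp
  ring

/-- The tangent line bound for the convex function `x ↦ x * log x` at `c`. -/
theorem mul_log_add_sub_le_mul_log {x c : ℝ} (hx : 0 ≤ x) (hc : 0 < c) :
    x * Real.log c + x - c ≤ x * Real.log x := by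
  rcases hx.eq_or_lt with rfl | hx
  · simpa using hc.le
  · have h := mul_le_mul_of_nonneg_left (Real.log_le_sub_one_of_pos (div_pos hc hx)) hx.le
    rw [Real.log_div hc.ne' hx.ne', mul_sub, mul_sub, mul_div_cancel₀ _ hx.ne'] at h
    linarith

/-- The equality case of the grouping bound `exp H' ≤ exp H + 1` for the entropy, where
`P = exp H` and a new weight `s` is added to a total weight `S`. -/
theorem mul_eq_of_log_add_one_eq {S s P : ℝ} (hS : 0 < S) (hs : 0 < s) (hP : 0 < P)
    (h : (S + s) * Real.log (P + 1) =
      (S + s) * Real.log (S + s) + S * Real.log P - S * Real.log S - s * Real.log s) :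
    s * P = S := by
  have hx : 0 < (S + s) / (s * (P + 1)) := by positivity
  have hy : 0 < (S + s) * P / (S * (P + 1)) := by positivity
  have lx : Real.log ((S + s) / (s * (P + 1))) =
      Real.log (S + s) - (Real.log s + Real.log (P + 1)) := by
    rw [Real.log_div (by positivity) (by positivity), Real.log_mul (by positivity) (by positivity)]
  have ly : Real.log ((S + s) * P / (S * (P + 1))) =
      Real.log (S + s) + Real.log P - (Real.log S + Real.log (P + 1)) := by
    rw [Real.log_div (by positivity) (by positivity), Real.log_mul (by positivity) (by positivity),
      Real.log_mul (by positivity) (by positivity)]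
  have hsum : s * ((S + s) / (s * (P + 1))) + S * ((S + s) * P / (S * (P + 1))) = S + s := by
    field_simp
    ring
  by_contra hne
  have hx1 : (S + s) / (s * (P + 1)) ≠ 1 := by
    rw [Ne, div_eq_one_iff_eq (by positivity)]
    intro h'
    apply hne
    linarith
  have h1 := mul_lt_mul_of_pos_left (Real.log_lt_sub_one_of_pos hx hx1) hs
  have h2 := mul_le_mul_of_nonneg_left (Real.log_le_sub_one_of_pos hy) hS.le
  rw [lx] at h1
  rw [ly] at h2
  linarith

section PartialEffectiveRank

variable {M : ℕ} (σ : Fin M → ℝ) (K : ℕ)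

theorem log_PER (h : K ≤ M) (hS : 0 < ∑ j : Fin K, σ (Fin.castLE h j)) :
    Real.log (PER σ K h) = Real.log (∑ j : Fin K, σ (Fin.castLE h j)) -
      (∑ k : Fin K, σ (Fin.castLE h k) * Real.log (σ (Fin.castLE h k))) /
        ∑ j : Fin K, σ (Fin.castLE h j) := by
  rw [PER, Real.log_exp]
  exact neg_sum_div_mul_log_div (fun k => σ (Fin.castLE h k)) hS

theorem PER_pos (h : K ≤ M) : 0 < PER σ K h := Real.exp_pos _

theorem PER_le (h : K ≤ M) (hnonneg : ∀ i, 0 ≤ σ i) (hK : 0 < K)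
    (hS : 0 < ∑ j : Fin K, σ (Fin.castLE h j)) : PER σ K h ≤ K := by
  have hK' : (0 : ℝ) < K := by exact_mod_cast hK
  rw [← Real.log_le_log_iff (PER_pos σ K h) hK', log_PER σ K h hS]
  set S := ∑ j : Fin K, σ (Fin.castLE h j) with hSdef
  have hsum := Finset.sum_le_sum fun (k : Fin K) (_ : k ∈ Finset.univ) =>
    mul_log_add_sub_le_mul_log (hnonneg (Fin.castLE h k)) (div_pos hS hK')
  rw [Finset.sum_sub_distrib, Finset.sum_add_distrib, ← Finset.sum_mul, ← hSdef,
    Finset.sum_const, Finset.card_univ, Fintype.card_fin, nsmul_eq_mul,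
    mul_div_cancel₀ _ hK'.ne', add_sub_cancel_right, Real.log_div hS.ne' hK'.ne'] at hsum
  have := (le_div_iff₀' hS).2 hsum
  linarith

theorem PER_of_forall_eq (h : K ≤ M) (hK : 0 < K) {c : ℝ} (hc : 0 < c)
    (hσ : ∀ k : Fin K, σ (Fin.castLE h k) = c) : PER σ K h = K := by
  have hK' : (0 : ℝ) < K := by exact_mod_cast hK
  have hS : 0 < ∑ j : Fin K, σ (Fin.castLE h j) := by
    simp only [hσ, Finset.sum_const, Finset.card_univ, Fintype.card_fin, nsmul_eq_mul]
    positivity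
  apply Real.log_injOn_pos (PER_pos σ K h) hK'
  rw [log_PER σ K h hS]
  simp only [hσ, Finset.sum_const, Finset.card_univ, Fintype.card_fin, nsmul_eq_mul]
  rw [Real.log_mul hK'.ne' hc.ne']
  field_simp
  ring

theorem log_PER_succ (h : K < M) (hs : 0 ≤ σ ⟨K, h⟩)
    (hS : 0 < ∑ j : Fin K, σ (Fin.castLE h.le j)) :
    (∑ j : Fin K, σ (Fin.castLE h.le j) + σ ⟨K, h⟩) * Real.log (PER σ (K + 1) h) =
      (∑ j : Fin K, σ (Fin.castLE h.le j) + σ ⟨K, h⟩) *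
          Real.log (∑ j : Fin K, σ (Fin.castLE h.le j) + σ ⟨K, h⟩) +
        (∑ j : Fin K, σ (Fin.castLE h.le j)) * Real.log (PER σ K h.le) -
        (∑ j : Fin K, σ (Fin.castLE h.le j)) * Real.log (∑ j : Fin K, σ (Fin.castLE h.le j)) -
        σ ⟨K, h⟩ * Real.log (σ ⟨K, h⟩) := by
  have hsplit : ∀ g : ℝ → ℝ, ∑ j : Fin (K + 1), g (σ (Fin.castLE h j)) =
      ∑ j : Fin K, g (σ (Fin.castLE h.le j)) + g (σ ⟨K, h⟩) := fun g =>
    Fin.sum_univ_castSucc _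
  have hS' := hsplit id
  simp only [id] at hS'
  rw [log_PER σ (K + 1) h (by rw [hS']; positivity), log_PER σ K h.le hS, hS',
    hsplit fun x => x * Real.log x]
  have : 0 < ∑ j : Fin K, σ (Fin.castLE h.le j) + σ ⟨K, h⟩ := by positivity
  field_simp
  ring

end PartialEffectiveRank

/-- For every `1 ≤ K < M`, the increment of the Partial Effective Rank equals one
exactly when the leading singular values are all equal:
`PER_{K+1} − PER_K = 1 ↔ σ 0 = σ 1 = ⋯ = σ K`
(the first `K+1` singular values, indexed from zero, are all equal). -/
theorem per_increment_eq_one_iff {M : ℕ} (σ : Fin M → ℝ) (hmono : Antitone σ)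
    (hnonneg : ∀ i, 0 ≤ σ i) (hM : 0 < M) (hpos : 0 < σ ⟨0, hM⟩)
    (K : ℕ) (hK1 : 1 ≤ K) (hKM : K < M) :
    PER σ (K + 1) hKM - PER σ K (le_of_lt hKM) = 1 ↔
      ∀ k : Fin M, (k : ℕ) ≤ K → σ k = σ ⟨0, hM⟩ := by
  have hS : 0 < ∑ j : Fin K, σ (Fin.castLE hKM.le j) :=
    Finset.sum_pos' (fun j _ => hnonneg _) ⟨⟨0, hK1⟩, Finset.mem_univ _, hpos⟩
  constructor
  · intro hinc
    have hsucc := log_PER_succ σ K hKM (hnonneg _) hS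
    have hP := PER_pos σ K hKM.le
    have hs : 0 < σ ⟨K, hKM⟩ := by
      refine (hnonneg _).lt_of_ne fun h0 => ?_
      rw [← h0, add_zero, zero_mul, sub_zero, add_sub_cancel_left] at hsucc
      have := Real.log_injOn_pos (PER_pos σ (K + 1) hKM) hP (mul_left_cancel₀ hS.ne' hsucc)
      linarith
    rw [sub_eq_iff_eq_add'.1 hinc] at hsucc
    have hsP := mul_eq_of_log_add_one_eq hS hs hP hsucc
    have hle : ∀ j ∈ (Finset.univ : Finset (Fin K)),
        σ ⟨K, hKM⟩ ≤ σ (Fin.castLE hKM.le j) := fun j _ => hmono j.isLt.le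
    have hKs : ∑ _j : Fin K, σ ⟨K, hKM⟩ = ∑ j : Fin K, σ (Fin.castLE hKM.le j) := by
      refine (Finset.sum_le_sum hle).antisymm ?_
      rw [← hsP, Finset.sum_const, Finset.card_univ, Fintype.card_fin, nsmul_eq_mul, mul_comm]
      exact mul_le_mul_of_nonneg_right (PER_le σ K hKM.le hnonneg hK1 hS) hs.le
    have h0 : σ ⟨K, hKM⟩ = σ ⟨0, hM⟩ :=
      (Finset.sum_eq_sum_iff_of_le hle).1 hKs ⟨0, hK1⟩ (Finset.mem_univ _)
    exact fun k hk => (hmono (Nat.zero_le _)).antisymm (h0 ▸ hmono hk)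
  · intro heq
    rw [PER_of_forall_eq σ (K + 1) hKM K.succ_pos hpos fun k => heq _ (Nat.le_of_lt_succ k.isLt),
      PER_of_forall_eq σ K hKM.le hK1 hpos fun k => heq _ k.isLt.le]
    push_cast
    ring
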